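/- Let H be a connected simple graph with minimum degree δ(H) ≥ 3. Then there is a constant C (depending only on H) such that for every sufficiently large n there exists an M(H)-saturated simple graph on n vertices with at most δ(H)·n + C edges. -/

import Mathlib

/-- `H.IsMinorOf G` : `H` is a minor of `G`, via the branch-set (model) definition:
there are pairwise disjoint nonempty connected subsets of `V(G)`, one for each vertex
of `H`, with an edge of `G` between the branch sets corresponding to each edge of `H`. -/
def SimpleGraph.IsMinorOf {W V : Type*} (H : SimpleGraph W) (G : SimpleGraph V) : Prop :=
  ∃ B : W → Set V,
    (∀ w, (B w).Nonempty) ∧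
    (∀ w, (G.induce (B w)).Connected) ∧
    (Pairwise fun w₁ w₂ => Disjoint (B w₁) (B w₂)) ∧
    ∀ ⦃w₁ w₂⦄, H.Adj w₁ w₂ → ∃ v₁ ∈ B w₁, ∃ v₂ ∈ B w₂, G.Adj v₁ v₂

/-- The graph `G + uv` obtained from `G` by adding the edge `uv`. -/
def SimpleGraph.addEdge {V : Type*} (G : SimpleGraph V) (u v : V) : SimpleGraph V :=
  G ⊔ SimpleGraph.fromEdgeSet {s(u, v)}

/-- `G` is `M(H)`-saturated: `G` has no `H`-minor, but adding any edge between two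
distinct non-adjacent vertices creates an `H`-minor. -/
def MinorSaturated {W V : Type*} (H : SimpleGraph W) (G : SimpleGraph V) : Prop :=
  ¬ H.IsMinorOf G ∧
    ∀ u v : V, u ≠ v → ¬ G.Adj u v → H.IsMinorOf (G.addEdge u v)

namespace SimpleGraph

lemma Preconnected.forall_of_adj {V : Type*} {G : SimpleGraph V} (hG : G.Preconnected)
    {P : V → Prop} (hP : ∀ a b, G.Adj a b → P a → P b) {a : V} (ha : P a) (b : V) : P b := by
  obtain ⟨p⟩ := hG a b
  induction p with
  | nil => exact ha
  | cons h _ ih => exact ih (hP _ _ h ha)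

lemma forall_mem_of_induce_preconnected {V : Type*} {G : SimpleGraph V} {S : Set V}
    (hS : (G.induce S).Preconnected) {P : V → Prop}
    (hP : ∀ a ∈ S, ∀ b ∈ S, G.Adj a b → P a → P b) {a : V} (ha : a ∈ S) (hPa : P a)
    {b : V} (hb : b ∈ S) : P b :=
  hS.forall_of_adj (P := fun x => P x.1) (fun x y hxy => hP x x.2 y y.2 hxy)
    (a := ⟨a, ha⟩) hPa ⟨b, hb⟩

lemma induce_singleton_connected {V : Type*} (G : SimpleGraph V) (v : V) :
    (G.induce {v}).Connected := by
  have : Subsingleton ({v} : Set V) := Set.subsingleton_singleton.coe_sort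
  exact ⟨Preconnected.of_subsingleton⟩

lemma induce_insert_connected {V : Type*} {G : SimpleGraph V} {S : Set V}
    (hS : (G.induce S).Connected) {u v : V} (hv : v ∈ S) (huv : G.Adj u v) :
    (G.induce (insert u S)).Connected := by
  have h := induce_union_connected (induce_pair_connected_of_adj huv).preconnected
    hS.preconnected ⟨v, by simp, hv⟩
  have hset : ({u, v} : Set V) ∪ S = insert u S := by
    ext z
    simp only [Set.mem_union, Set.mem_insert_iff, Set.mem_singleton_iff]
    grind
  rwa [hset] at h

lemma addEdge_adj {V : Type*} {G : SimpleGraph V} {u v a b : V} :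
    (G.addEdge u v).Adj a b ↔ G.Adj a b ∨ (s(a, b) = s(u, v) ∧ a ≠ b) := by
  simp [addEdge]

lemma le_addEdge {V : Type*} (G : SimpleGraph V) (u v : V) : G ≤ G.addEdge u v := le_sup_left

lemma addEdge_adj_self {V : Type*} (G : SimpleGraph V) {u v : V} (h : u ≠ v) :
    (G.addEdge u v).Adj u v := addEdge_adj.2 (Or.inr ⟨rfl, h⟩)

lemma addEdge_comm {V : Type*} (G : SimpleGraph V) (u v : V) :
    G.addEdge u v = G.addEdge v u := by
  simp [addEdge, Sym2.eq_swap]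

lemma IsMinorOf.of_iso {W V V' : Type*} {H : SimpleGraph W} {G : SimpleGraph V}
    {G' : SimpleGraph V'} (e : G ≃g G') (h : H.IsMinorOf G) : H.IsMinorOf G' := by
  obtain ⟨B, hne, hc, hd, ha⟩ := h
  refine ⟨fun w => e '' B w, fun w => (hne w).image e, fun w => ?_, fun w₁ w₂ hw => ?_, ?_⟩
  · let f : G.induce (B w) ≃g G'.induce (e '' B w) :=
      { toEquiv := e.toEquiv.image (B w)
        map_rel_iff' := by
          intro a b
          exact e.map_adj_iff }
    exact f.connected_iff.1 (hc w)
  · exact (Set.disjoint_image_iff e.injective).2 (hd hw)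
  · intro w₁ w₂ hw
    obtain ⟨v₁, h₁, v₂, h₂, hv⟩ := ha hw
    exact ⟨e v₁, ⟨v₁, h₁, rfl⟩, e v₂, ⟨v₂, h₂, rfl⟩, e.map_adj_iff.2 hv⟩

/-- A model of `H` in which at most one branch set, that of `w₀`, is not a singleton. -/
lemma isMinorOf_of_hub {W V : Type*} {H : SimpleGraph W} {G : SimpleGraph V} (w₀ : W)
    {S : Set V} (hS : (G.induce S).Connected) (g : W → V)
    (hinj : ∀ w w', w ≠ w₀ → w' ≠ w₀ → g w = g w' → w = w')
    (hgS : ∀ w, w ≠ w₀ → g w ∉ S)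
    (hadj : ∀ w w', w ≠ w₀ → w' ≠ w₀ → H.Adj w w' → G.Adj (g w) (g w'))
    (hhub : ∀ w, H.Adj w₀ w → ∃ s ∈ S, G.Adj s (g w)) : H.IsMinorOf G := by
  classical
  refine ⟨fun w => if w = w₀ then S else {g w}, fun w => ?_, fun w => ?_, fun w w' hw => ?_, ?_⟩
  · dsimp only
    split_ifs
    · exact Set.nonempty_coe_sort.1 hS.nonempty
    · exact Set.singleton_nonempty _
  · dsimp only
    by_cases h : w = w₀
    · rw [if_pos h]
      exact hS
    · rw [if_neg h]
      exact induce_singleton_connected G _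
  · dsimp only
    split_ifs with h h' h'
    · exact absurd (h.trans h'.symm) hw
    · exact Set.disjoint_singleton_right.2 (hgS _ h')
    · exact Set.disjoint_singleton_left.2 (hgS _ h)
    · exact Set.disjoint_singleton.2 fun he => hw (hinj _ _ h h' he)
  · intro w w' hw
    dsimp only
    split_ifs with h h' h'
    · exact absurd (h.trans h'.symm) hw.ne
    · obtain ⟨s, hs, hsg⟩ := hhub w' (h ▸ hw)
      exact ⟨s, hs, g w', rfl, hsg⟩
    · obtain ⟨s, hs, hsg⟩ := hhub w (h' ▸ hw.symm)
      exact ⟨g w, rfl, s, hs, hsg.symm⟩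
    · exact ⟨g w, rfl, g w', rfl, hadj _ _ h h' hw⟩

lemma _root_.Finset.exists_mapsTo_injOn {α β : Type*} [Nonempty β] {s : Finset α} {t : Finset β}
    (h : s.card ≤ t.card) : ∃ f : α → β, (∀ a ∈ s, f a ∈ t) ∧ Set.InjOn f s := by
  classical
  obtain ⟨t', ht', hc⟩ := Finset.exists_subset_card_eq h
  let e := Finset.equivOfCardEq hc.symm
  refine ⟨fun a => if ha : a ∈ s then e ⟨a, ha⟩ else Classical.arbitrary β, fun a ha => ?_, ?_⟩
  · simp only [ha, dite_true]
    exact ht' (e ⟨a, ha⟩).2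
  · intro a ha b hb hab
    rw [Finset.mem_coe] at ha hb
    simp only [ha, hb, dite_true] at hab
    simpa using e.injective (Subtype.ext hab)

/-- A clique on `|H| - 1` vertices together with a connected set having at least `δ(H)`
neighbours in it contains `H` as a minor. -/
lemma isMinorOf_of_clique {W V : Type*} [Fintype W] [Nonempty W] {H : SimpleGraph W}
    [DecidableRel H.Adj] {G : SimpleGraph V} {C T : Finset V} (hC : G.IsClique (C : Set V))
    (hcard : C.card + 1 = Fintype.card W) (hTC : T ⊆ C) (hT : H.minDegree ≤ T.card)
    {S : Set V} (hS : (G.induce S).Connected) (hSC : ∀ s ∈ S, s ∉ C)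
    (hST : ∀ t ∈ T, ∃ s ∈ S, G.Adj s t) : H.IsMinorOf G := by
  classical
  obtain ⟨w₀, hw₀⟩ := H.exists_minimal_degree_vertex
  rw [hw₀] at hT
  obtain ⟨T', hT', hT'c⟩ := Finset.exists_subset_card_eq hT
  have : Nonempty V := ⟨(Set.nonempty_coe_sort.1 hS.nonempty).some⟩
  obtain ⟨f, hf, hfi⟩ := Finset.exists_mapsTo_injOn (s := H.neighborFinset w₀) (t := T')
    (by rw [hT'c, card_neighborFinset_eq_degree])
  have hw₀N : w₀ ∉ H.neighborFinset w₀ := by simp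
  obtain ⟨g, hg, hgi⟩ := Finset.exists_mapsTo_injOn
    (s := (insert w₀ (H.neighborFinset w₀))ᶜ) (t := C \ T') (by
      rw [Finset.card_compl, Finset.card_insert_of_notMem hw₀N,
        Finset.card_sdiff_of_subset (hT'.trans hTC), hT'c, card_neighborFinset_eq_degree]
      omega)
  have hgC : ∀ w, w ≠ w₀ → ¬ H.Adj w₀ w → g w ∈ C ∧ g w ∉ T' := fun w h h' => by
    simpa using hg w (by simp [h, h'])
  have hfT : ∀ w, H.Adj w₀ w → f w ∈ T' := fun w h => hf w (by simpa using h)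
  let F : W → V := fun w => if H.Adj w₀ w then f w else g w
  have hF : ∀ w, w ≠ w₀ → F w ∈ C := fun w h => by
    by_cases h' : H.Adj w₀ w
    · simpa [F, h'] using hTC (hT' (hfT w h'))
    · simpa [F, h'] using (hgC w h h').1
  have hFi : ∀ w w', w ≠ w₀ → w' ≠ w₀ → F w = F w' → w = w' := by
    intro w w' h h' he
    by_cases ha : H.Adj w₀ w <;> by_cases ha' : H.Adj w₀ w' <;> simp only [F, ha, ha', if_true,
      if_false] at he
    · exact hfi (by simpa using ha) (by simpa using ha') he
    · exact absurd (he ▸ hfT w ha) (hgC w' h' ha').2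
    · exact absurd (he ▸ hfT w' ha') (hgC w h ha).2
    · exact hgi (by simp [h, ha]) (by simp [h', ha']) he
  refine isMinorOf_of_hub w₀ hS F hFi (fun w hw hs => hSC _ hs (hF w hw)) ?_ ?_
  · intro w w' h h' ha
    exact hC (hF w h) (hF w' h') fun he => ha.ne (hFi _ _ h h' he)
  · intro w ha
    simpa [F, ha] using hST _ (hT' (hfT w ha))

/-- `Z` separates `H`: deleting `Z` leaves a disconnected graph. -/
def IsSep {W : Type*} (H : SimpleGraph W) (Z : Finset W) : Prop :=
  ∃ A : Finset W, A.Nonempty ∧ Disjoint A Z ∧ (∃ b, b ∉ A ∧ b ∉ Z) ∧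
    ∀ a ∈ A, ∀ b, b ∉ A → b ∉ Z → ¬ H.Adj a b

/-- Two cliques on `|H| - 1` vertices that share a clique `K` with `|K| + 1` the size of a
separator of `H`, together with a connection avoiding `K`, contain `H` as a minor. -/
lemma isMinorOf_of_two_cliques_of_isSep {W V : Type*} [Fintype W] {H : SimpleGraph W}
    {G : SimpleGraph V} {K C₁ C₂ : Finset V}
    (hC₁ : G.IsClique (C₁ : Set V)) (hC₂ : G.IsClique (C₂ : Set V))
    (hcard₁ : C₁.card + 1 = Fintype.card W) (hcard₂ : C₂.card + 1 = Fintype.card W)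
    (hK₁ : K ⊆ C₁) (hK₂ : K ⊆ C₂) (hK : ∀ v ∈ C₁, v ∈ C₂ → v ∈ K)
    {Z : Finset W} (hZ : H.IsSep Z) (hZK : K.card + 1 = Z.card)
    {x y : V} (hx : x ∈ C₁) (hxK : x ∉ K) (hy : y ∈ C₂) (hyK : y ∉ K)
    {S : Set V} (hS : (G.induce S).Connected) (hSC₁ : ∀ s ∈ S, s ∉ C₁)
    (hSC₂ : ∀ s ∈ S, s ∈ C₂ → s = y) (hyS : y ∈ S) (hxS : ∃ s ∈ S, G.Adj x s) :
    H.IsMinorOf G := by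
  classical
  obtain ⟨s₀, hs₀, hxs₀⟩ := hxS
  obtain ⟨A, ⟨a, ha⟩, hAZ, ⟨b, hbA, hbZ⟩, hsep⟩ := hZ
  obtain ⟨w₀, hw₀⟩ : Z.Nonempty := Finset.card_pos.1 (by omega)
  have : Nonempty V := ⟨x⟩
  have hAZc : (A ∪ Z).card + (A ∪ Z)ᶜ.card = Fintype.card W := Finset.card_add_card_compl _
  rw [Finset.card_union_of_disjoint hAZ] at hAZc
  have hA : 0 < A.card := Finset.card_pos.2 ⟨a, ha⟩
  have hD : 0 < (A ∪ Z)ᶜ.card := Finset.card_pos.2 ⟨b, by simp [hbA, hbZ]⟩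
  obtain ⟨f, hf, hfi⟩ := Finset.exists_mapsTo_injOn (s := Z.erase w₀) (t := K)
    (by rw [Finset.card_erase_of_mem hw₀]; omega)
  obtain ⟨g₁, hg₁, hg₁i⟩ := Finset.exists_mapsTo_injOn (s := A) (t := C₁ \ insert x K) (by
    rw [Finset.card_sdiff_of_subset (Finset.insert_subset hx hK₁),
      Finset.card_insert_of_notMem hxK]
    omega)
  obtain ⟨g₂, hg₂, hg₂i⟩ := Finset.exists_mapsTo_injOn (s := (A ∪ Z)ᶜ) (t := C₂ \ insert y K) (by
    rw [Finset.card_sdiff_of_subset (Finset.insert_subset hy hK₂),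
      Finset.card_insert_of_notMem hyK]
    omega)
  let F : W → V := fun w => if w ∈ Z then f w else if w ∈ A then g₁ w else g₂ w
  have hFZ : ∀ w ∈ Z, F w = f w := fun w h => by simp [F, h]
  have hFA : ∀ w ∈ A, F w = g₁ w := fun w h => by
    simp [F, h, Finset.disjoint_left.1 hAZ h]
  have hFD : ∀ w, w ∉ A → w ∉ Z → F w = g₂ w := fun w h h' => by simp [F, h, h']
  have hFZK : ∀ w ∈ Z, w ≠ w₀ → F w ∈ K := fun w h h' => by
    rw [hFZ w h]; exact hf w (by simp [h, h'])
  have hFA₁ : ∀ w ∈ A, F w ∈ C₁ ∧ F w ≠ x ∧ F w ∉ K := fun w h => by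
    rw [hFA w h]; simpa using hg₁ w h
  have hFD₂ : ∀ w, w ∉ A → w ∉ Z → F w ∈ C₂ ∧ F w ≠ y ∧ F w ∉ K := fun w h h' => by
    rw [hFD w h h']; simpa using hg₂ w (by simp [h, h'])
  have hFi : ∀ w w', w ≠ w₀ → w' ≠ w₀ → F w = F w' → w = w' := by
    intro w w' h h' he
    by_cases hwZ : w ∈ Z
    · have h1 := hFZK w hwZ h
      by_cases hwZ' : w' ∈ Z
      · rw [hFZ w hwZ, hFZ w' hwZ'] at he
        exact hfi (by simp [h, hwZ]) (by simp [h', hwZ']) he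
      · by_cases hwA' : w' ∈ A
        · exact absurd (he ▸ h1) (hFA₁ w' hwA').2.2
        · exact absurd (he ▸ h1) (hFD₂ w' hwA' hwZ').2.2
    · by_cases hwZ' : w' ∈ Z
      · have h1 := hFZK w' hwZ' h'
        by_cases hwA : w ∈ A
        · exact absurd (he ▸ h1) (hFA₁ w hwA).2.2
        · exact absurd (he ▸ h1) (hFD₂ w hwA hwZ).2.2
      · by_cases hwA : w ∈ A <;> by_cases hwA' : w' ∈ A
        · rw [hFA w hwA, hFA w' hwA'] at he
          exact hg₁i hwA hwA' he
        · have h1 := hFA₁ w hwA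
          exact absurd (hK _ h1.1 (he ▸ (hFD₂ w' hwA' hwZ').1)) h1.2.2
        · have h1 := hFA₁ w' hwA'
          exact absurd (hK _ h1.1 (he ▸ (hFD₂ w hwA hwZ).1)) h1.2.2
        · rw [hFD w hwA hwZ, hFD w' hwA' hwZ'] at he
          exact hg₂i (by simp [hwA, hwZ]) (by simp [hwA', hwZ']) he
  have hcases : ∀ w, w ≠ w₀ → (F w ∈ C₁ ∧ F w ≠ x) ∨ (F w ∈ C₂ ∧ F w ≠ y ∧ F w ∉ K) := by
    intro w hw
    by_cases hwZ : w ∈ Z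
    · have := hFZK w hwZ hw
      exact Or.inl ⟨hK₁ this, fun h => hxK (h ▸ this)⟩
    · by_cases hwA : w ∈ A
      · exact Or.inl ⟨(hFA₁ w hwA).1, (hFA₁ w hwA).2.1⟩
      · exact Or.inr (hFD₂ w hwA hwZ)
  refine isMinorOf_of_hub w₀ (induce_insert_connected hS hs₀ hxs₀) F hFi ?_ ?_ ?_
  · intro w hw hmem
    rcases hcases w hw with ⟨h1, h2⟩ | ⟨h1, h2, h3⟩
    · rcases hmem with h | h
      · exact h2 h
      · exact hSC₁ _ h h1
    · rcases hmem with h | h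
      · exact h3 (hK _ (h ▸ hx) h1)
      · exact h2 (hSC₂ _ h h1)
  · intro w w' h h' hadj
    have hne : F w ≠ F w' := fun he => hadj.ne (hFi _ _ h h' he)
    by_cases hwA : w ∈ A
    · by_cases hw : w' ∈ A ∨ w' ∈ Z
      · refine hC₁ (hFA₁ w hwA).1 ?_ hne
        rcases hw with hw | hw
        · exact (hFA₁ w' hw).1
        · exact hK₁ (hFZK w' hw h')
      · push Not at hw
        exact absurd hadj (hsep w hwA w' hw.1 hw.2)
    · by_cases hwA' : w' ∈ A
      · by_cases hwZ : w ∈ Z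
        · exact hC₁ (hK₁ (hFZK w hwZ h)) (hFA₁ w' hwA').1 hne
        · exact absurd hadj.symm (hsep w' hwA' w hwA hwZ)
      · have aux : ∀ w, w ≠ w₀ → w ∉ A → F w ∈ C₂ := fun w h hA => by
          by_cases hwZ : w ∈ Z
          · exact hK₂ (hFZK w hwZ h)
          · exact (hFD₂ w hA hwZ).1
        exact hC₂ (aux w h hwA) (aux w' h' hwA') hne
  · intro w hadj
    rcases hcases w hadj.ne' with ⟨h1, h2⟩ | ⟨h1, h2, -⟩
    · exact ⟨x, Set.mem_insert _ _, hC₁ hx h1 h2.symm⟩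
    · exact ⟨y, Set.mem_insert_of_mem _ hyS, hC₂ hy h1 h2.symm⟩

lemma isMinorOf_of_two_cliques {W V : Type*} [Fintype W] [Nonempty W] {H : SimpleGraph W}
    [DecidableRel H.Adj] {G : SimpleGraph V} {K C₁ C₂ : Finset V}
    (hC₁ : G.IsClique (C₁ : Set V)) (hC₂ : G.IsClique (C₂ : Set V))
    (hcard₁ : C₁.card + 1 = Fintype.card W) (hcard₂ : C₂.card + 1 = Fintype.card W)
    (hK₁ : K ⊆ C₁) (hK₂ : K ⊆ C₂) (hK : ∀ v ∈ C₁, v ∈ C₂ → v ∈ K)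
    (hH : K.card + 1 = H.minDegree ∨ ∃ Z : Finset W, H.IsSep Z ∧ K.card + 1 = Z.card)
    {x y : V} (hx : x ∈ C₁) (hxK : x ∉ K) (hy : y ∈ C₂) (hyK : y ∉ K)
    {S : Set V} (hS : (G.induce S).Connected) (hSC₁ : ∀ s ∈ S, s ∉ C₁)
    (hSC₂ : ∀ s ∈ S, s ∈ C₂ → s = y) (hyS : y ∈ S) (hxS : ∃ s ∈ S, G.Adj x s) :
    H.IsMinorOf G := by
  classical
  rcases hH with hH | ⟨Z, hZ, hZK⟩
  · refine isMinorOf_of_clique hC₁ hcard₁ (Finset.insert_subset hx hK₁)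
      (by rw [Finset.card_insert_of_notMem hxK, hH]) hS hSC₁ fun t ht => ?_
    rcases Finset.mem_insert.1 ht with rfl | ht
    · obtain ⟨s, hs, h⟩ := hxS
      exact ⟨s, hs, h.symm⟩
    · exact ⟨y, hyS, hC₂ hy (hK₂ ht) fun h => hyK (h ▸ ht)⟩
  · exact isMinorOf_of_two_cliques_of_isSep hC₁ hC₂ hcard₁ hcard₂ hK₁ hK₂ hK hZ hZK hx hxK hy hyK
      hS hSC₁ hSC₂ hyS hxS

lemma not_isSep_empty {W : Type*} {H : SimpleGraph W} (hH : H.Connected) : ¬ H.IsSep ∅ := by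
  rintro ⟨A, ⟨a, ha⟩, -, ⟨b, hb, -⟩, h⟩
  refine hb (hH.preconnected.forall_of_adj (P := (· ∈ A)) (fun x y hxy hx => ?_) ha b)
  by_contra hy
  exact h x hx y hy (by simp) hxy

/-- A number `k < δ(H)` such that `H` is `(k + 1)`-connected, and either `k + 1 = δ(H)` or
`k + 1` is the connectivity of `H`. -/
lemma exists_card_isSep {W : Type*} [Fintype W] {H : SimpleGraph W} [DecidableRel H.Adj]
    (hH : H.Connected) (hδ : 0 < H.minDegree) :
    ∃ k, k + 1 ≤ H.minDegree ∧ (∀ Z : Finset W, Z.card ≤ k → ¬ H.IsSep Z) ∧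
      (k + 1 = H.minDegree ∨ ∃ Z : Finset W, H.IsSep Z ∧ k + 1 = Z.card) := by
  classical
  by_cases hex : ∃ m, m < H.minDegree ∧ ∃ Z : Finset W, H.IsSep Z ∧ Z.card = m
  · obtain ⟨hm, Z, hZ, hZm⟩ := Nat.find_spec hex
    have hmin := fun m => Nat.find_min hex (m := m)
    generalize Nat.find hex = m at hm hZm hmin
    have hm0 : m ≠ 0 := by
      rintro rfl
      rw [Finset.card_eq_zero] at hZm
      exact not_isSep_empty hH (hZm ▸ hZ)
    obtain ⟨k, rfl⟩ := Nat.exists_eq_succ_of_ne_zero hm0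
    refine ⟨k, by omega, fun Z' hZ' hs => ?_, Or.inr ⟨Z, hZ, by omega⟩⟩
    exact hmin Z'.card (by omega) ⟨by omega, Z', hs, rfl⟩
  · refine ⟨H.minDegree - 1, by omega, fun Z hZ hs => ?_, Or.inl (by omega)⟩
    exact hex ⟨Z.card, by omega, Z, hs, rfl⟩

lemma IsSep.minDegree_add_two_le {W : Type*} [Fintype W] {H : SimpleGraph W} [DecidableRel H.Adj]
    {Z : Finset W} (hZ : H.IsSep Z) : H.minDegree + 2 ≤ Fintype.card W := by
  classical
  obtain ⟨A, ⟨a, ha⟩, hAZ, ⟨b, hbA, hbZ⟩, hsep⟩ := hZ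
  have hab := hsep a ha b hbA hbZ
  have hne : a ≠ b := fun h => hbA (h ▸ ha)
  have hsub : H.neighborFinset a ⊆ ({a, b} : Finset W)ᶜ := fun w hw => by
    have hw' : H.Adj a w := by simpa using hw
    simp only [Finset.mem_compl, Finset.mem_insert, Finset.mem_singleton, not_or]
    exact ⟨hw'.ne', fun h => hab (h ▸ hw')⟩
  have h1 := Finset.card_le_card hsub
  have h2 := Finset.card_add_card_compl ({a, b} : Finset W)
  rw [Finset.card_pair hne] at h2
  rw [card_neighborFinset_eq_degree] at h1
  have := H.minDegree_le_degree a
  omega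

end SimpleGraph

/-- Vertex sets `core i` that pairwise meet in `K`, and `d`-element subsets `N a` of them. -/
structure CliqueSystem {V ι A : Type*} (core : ι → Finset V) (K : Finset V) (N : A → Finset V)
    (blk : A → ι) (m d : ℕ) : Prop where
  subset_core : ∀ i, K ⊆ core i
  mem_of_ne : ∀ i j, i ≠ j → ∀ v ∈ core i, v ∈ core j → v ∈ K
  cover : ∀ v, ∃ i, v ∈ core i
  card_core : ∀ i, (core i).card = m
  nbr_subset : ∀ a, N a ⊆ core (blk a)
  card_nbr : ∀ a, (N a).card = d
  exists_nbr : ∀ a, ∃ v ∈ N a, v ∉ K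
  nbr_injective : Function.Injective N

namespace CliqueSystem

/-- The union of the complete graphs on the sets `core i`, together with new independent vertices,
the vertex `a` having neighbourhood `N a`. -/
def graph {V ι A : Type*} (core : ι → Finset V) (N : A → Finset V) : SimpleGraph (V ⊕ A) where
  Adj
    | .inl x, .inl y => x ≠ y ∧ ∃ i, x ∈ core i ∧ y ∈ core i
    | .inl x, .inr a => x ∈ N a
    | .inr a, .inl x => x ∈ N a
    | .inr _, .inr _ => False
  symm := ⟨by
    rintro (x | a) (y | b) h
    · exact ⟨h.1.symm, h.2.imp fun _ => And.symm⟩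
    · exact h
    · exact h
    · exact h⟩
  loopless := ⟨by
    rintro (x | a) h
    · exact h.1 rfl
    · exact h⟩

section

variable {V ι A : Type*} {core : ι → Finset V} {K : Finset V} {N : A → Finset V} {blk : A → ι}
  {m d : ℕ}

@[simp] lemma graph_adj_inl_inl {x y : V} : (graph core N).Adj (.inl x) (.inl y) ↔
    x ≠ y ∧ ∃ i, x ∈ core i ∧ y ∈ core i := Iff.rfl

@[simp] lemma graph_adj_inl_inr {x : V} {a : A} :
    (graph core N).Adj (.inl x) (.inr a) ↔ x ∈ N a := Iff.rfl

@[simp] lemma graph_adj_inr_inl {x : V} {a : A} :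
    (graph core N).Adj (.inr a) (.inl x) ↔ x ∈ N a := Iff.rfl

@[simp] lemma graph_adj_inr_inr {a b : A} :
    ¬ (graph core N).Adj (.inr a) (.inr b) := id

lemma isClique_core (i : ι) {G : SimpleGraph (V ⊕ A)} (hG : graph core N ≤ G) :
    G.IsClique (((core i).map .inl : Finset (V ⊕ A)) : Set (V ⊕ A)) := by
  intro p hp q hq hne
  rw [Finset.mem_coe, Finset.mem_map] at hp hq
  obtain ⟨x, hx, rfl⟩ := hp
  obtain ⟨y, hy, rfl⟩ := hq
  exact hG ⟨fun h => hne (h ▸ rfl), i, hx, hy⟩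

/-- The vertices belonging to the block `i`. -/
def InBlock (core : ι → Finset V) (blk : A → ι) (i : ι) : V ⊕ A → Prop
  | .inl x => x ∈ core i
  | .inr a => blk a = i

lemma inBlock_of_adj (hS : CliqueSystem core K N blk m d) {i : ι} {p q : V ⊕ A}
    (hpq : (graph core N).Adj p q) (hp : ∀ x ∈ K, p ≠ .inl x) (hq : ∀ x ∈ K, q ≠ .inl x)
    (h : InBlock core blk i p) : InBlock core blk i q := by
  rcases p with x | a <;> rcases q with y | b
  · obtain ⟨-, j, hxj, hyj⟩ := hpq
    have hxK : x ∉ K := fun hx => hp x hx rfl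
    have hij : i = j := by
      by_contra hij
      exact hxK (hS.mem_of_ne i j hij x h hxj)
    exact hij ▸ hyj
  · have hxK : x ∉ K := fun hx => hp x hx rfl
    by_contra hne
    exact hxK (hS.mem_of_ne _ _ hne x (hS.nbr_subset b hpq) h)
  · have h' : blk a = i := h
    exact h' ▸ hS.nbr_subset a hpq
  · exact hpq.elim

lemma exists_inl_mem_of_model {W : Type*} [Fintype W] {H : SimpleGraph W} [DecidableRel H.Adj]
    (hS : CliqueSystem core K N blk m d) (hd : d < H.minDegree) {B : W → Set (V ⊕ A)}
    (hne : ∀ w, (B w).Nonempty) (hc : ∀ w, ((graph core N).induce (B w)).Connected)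
    (hdis : Pairwise fun w₁ w₂ => Disjoint (B w₁) (B w₂))
    (hadj : ∀ ⦃w₁ w₂⦄, H.Adj w₁ w₂ → ∃ v₁ ∈ B w₁, ∃ v₂ ∈ B w₂, (graph core N).Adj v₁ v₂) (w : W) :
    ∃ x, Sum.inl x ∈ B w := by
  classical
  by_contra! hno
  obtain ⟨p, hp⟩ := hne w
  rcases p with x | a
  · exact hno x hp
  have hall : ∀ q ∈ B w, q = .inr a := fun q hq => by
    refine SimpleGraph.forall_mem_of_induce_preconnected (hc w).preconnected
      (P := fun q => q = .inr a) ?_ hp rfl hq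
    rintro u hu v hv huv rfl
    rcases v with y | b
    · exact absurd hv (hno y)
    · exact huv.elim
  have hex : ∀ w', H.Adj w w' → ∃ x ∈ N a, Sum.inl x ∈ B w' := by
    intro w' hw'
    obtain ⟨u, hu, v, hv, huv⟩ := hadj hw'
    obtain rfl := hall u hu
    rcases v with y | b
    · exact ⟨y, huv, hv⟩
    · exact huv.elim
  obtain ⟨v₀, -, -⟩ := hS.exists_nbr a
  have hex' : ∀ w', ∃ x, H.Adj w w' → x ∈ N a ∧ Sum.inl x ∈ B w' := fun w' => by
    by_cases h : H.Adj w w'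
    · obtain ⟨x, hx⟩ := hex w' h
      exact ⟨x, fun _ => hx⟩
    · exact ⟨v₀, fun h' => absurd h' h⟩
  choose f hf using hex'
  have hcard : (H.neighborFinset w).card ≤ (N a).card := by
    refine Finset.card_le_card_of_injOn f (fun w' hw' => (hf w' (by simpa using hw')).1) ?_
    intro w₁ h₁ w₂ h₂ he
    by_contra hw
    refine Set.disjoint_left.1 (hdis hw) (hf w₁ (by simpa using h₁)).2 ?_
    rw [he]
    exact (hf w₂ (by simpa using h₂)).2
  rw [hS.card_nbr, SimpleGraph.card_neighborFinset_eq_degree] at hcard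
  have := H.minDegree_le_degree w
  omega

theorem not_isMinorOf {W : Type*} [Fintype W] {H : SimpleGraph W} [DecidableRel H.Adj]
    (hS : CliqueSystem core K N blk m d) (hm : m < Fintype.card W) (hd : d < H.minDegree)
    (hsep : ∀ Z : Finset W, Z.card ≤ K.card → ¬ H.IsSep Z) (hK : K.card < Fintype.card W) :
    ¬ H.IsMinorOf (graph core N) := by
  classical
  rintro ⟨B, hne, hc, hdis, hadj⟩
  have hinl := hS.exists_inl_mem_of_model hd hne hc hdis hadj
  let Z : Finset W := Finset.univ.filter fun w => ∃ x ∈ K, Sum.inl x ∈ B w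
  have hinj : ∀ w w' (p : V ⊕ A), p ∈ B w → p ∈ B w' → w = w' := fun w w' p h h' => by
    by_contra hw
    exact Set.disjoint_left.1 (hdis hw) h h'
  choose r hr using hinl
  have hZK : Z.card ≤ K.card := by
    have hex : ∀ w, ∃ x, w ∈ Z → x ∈ K ∧ Sum.inl x ∈ B w := fun w => by
      by_cases h : w ∈ Z
      · obtain ⟨x, hx⟩ := (Finset.mem_filter.1 h).2
        exact ⟨x, fun _ => hx⟩
      · exact ⟨r w, fun h' => absurd h' h⟩
    choose f hf using hex
    refine Finset.card_le_card_of_injOn f (fun w hw => (hf w hw).1) ?_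
    intro w₁ h₁ w₂ h₂ he
    exact hinj _ _ _ (hf w₁ h₁).2 (he ▸ (hf w₂ h₂).2)
  have hZ : ∀ w, w ∉ Z → ∀ p ∈ B w, ∀ x ∈ K, p ≠ .inl x := by
    rintro w hw p hp x hx rfl
    exact hw (Finset.mem_filter.2 ⟨Finset.mem_univ _, x, hx, hp⟩)
  obtain ⟨w₁, hw₁⟩ : ∃ w, w ∉ Z := by
    by_contra! h
    rw [(Finset.eq_univ_iff_forall.2 h), Finset.card_univ] at hZK
    omega
  obtain ⟨i, hi⟩ := hS.cover (r w₁)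
  have hblock : ∀ w, w ∉ Z → ∀ p ∈ B w, InBlock core blk i p → ∀ q ∈ B w, InBlock core blk i q := by
    intro w hw p hp hpi q hq
    exact SimpleGraph.forall_mem_of_induce_preconnected (hc w).preconnected
      (P := InBlock core blk i)
      (fun u hu v hv huv => hS.inBlock_of_adj huv (hZ w hw u hu) (hZ w hw v hv)) hp hpi hq
  have hall : ∀ w, w ∉ Z → ∀ p ∈ B w, InBlock core blk i p := by
    by_contra! hcon
    obtain ⟨w₂, hw₂, p₂, hp₂, hp₂i⟩ := hcon
    refine hsep Z hZK ⟨Finset.univ.filter fun w => w ∉ Z ∧ ∀ p ∈ B w, InBlock core blk i p,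
      ⟨w₁, ?_⟩, ?_, ⟨w₂, ?_, hw₂⟩, ?_⟩
    · exact Finset.mem_filter.2 ⟨Finset.mem_univ _, hw₁, hblock w₁ hw₁ _ (hr w₁) hi⟩
    · exact Finset.disjoint_left.2 fun w hw => (Finset.mem_filter.1 hw).2.1
    · exact fun h => hp₂i ((Finset.mem_filter.1 h).2.2 p₂ hp₂)
    · intro a ha b hb hbZ hab
      obtain ⟨haZ, hai⟩ := (Finset.mem_filter.1 ha).2
      obtain ⟨u, hu, v, hv, huv⟩ := hadj hab
      refine hb (Finset.mem_filter.2 ⟨Finset.mem_univ _, hbZ, hblock b hbZ v hv ?_⟩)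
      exact hS.inBlock_of_adj huv (hZ a haZ u hu) (hZ b hbZ v hv) (hai u hu)
  have hrep : ∀ w, ∃ x ∈ core i, Sum.inl x ∈ B w := by
    intro w
    by_cases hw : w ∈ Z
    · obtain ⟨x, hx, hxB⟩ := (Finset.mem_filter.1 hw).2
      exact ⟨x, hS.subset_core i hx, hxB⟩
    · exact ⟨r w, hall w hw _ (hr w), hr w⟩
  choose g hg hgB using hrep
  have hcard : (Finset.univ : Finset W).card ≤ (core i).card :=
    Finset.card_le_card_of_injOn g (fun w _ => hg w) fun w₁ _ w₂ _ he =>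
      hinj _ _ _ (hgB w₁) (he ▸ hgB w₂)
  rw [hS.card_core, Finset.card_univ] at hcard
  omega

variable {W : Type*} [Fintype W] [Nonempty W] {H : SimpleGraph W} [DecidableRel H.Adj]

lemma isMinorOf_of_two_cores (hS : CliqueSystem core K N blk m d) (hm : m + 1 = Fintype.card W)
    (hH : K.card + 1 = H.minDegree ∨ ∃ Z : Finset W, H.IsSep Z ∧ K.card + 1 = Z.card)
    {G : SimpleGraph (V ⊕ A)} (hG : graph core N ≤ G) {i j : ι} (hij : i ≠ j) {x y : V}
    (hx : x ∈ core i) (hxK : x ∉ K) (hy : y ∈ core j) (hyK : y ∉ K) {S : Set (V ⊕ A)}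
    (hSc : (G.induce S).Connected) (hSy : ∀ z, .inl z ∈ S ↔ z = y)
    (hxS : ∃ s ∈ S, G.Adj (.inl x) s) : H.IsMinorOf G := by
  refine SimpleGraph.isMinorOf_of_two_cliques (K := K.map .inl) (isClique_core i hG)
    (isClique_core j hG) (by simp [hS.card_core, hm]) (by simp [hS.card_core, hm])
    (Finset.map_subset_map.2 (hS.subset_core i)) (Finset.map_subset_map.2 (hS.subset_core j))
    ?_ (by simpa using hH) (x := .inl x) (y := .inl y) (by simpa using hx) (by simpa using hxK)
    (by simpa using hy) (by simpa using hyK) hSc ?_ ?_ ((hSy y).2 rfl) hxS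
  · simp only [Finset.mem_map, forall_exists_index, and_imp]
    rintro _ z hz rfl z' hz' he
    obtain rfl : z' = z := Sum.inl_injective he
    exact ⟨z', hS.mem_of_ne i j hij z' hz hz', rfl⟩
  · intro s hs hs'
    obtain ⟨z, hz, rfl⟩ := Finset.mem_map.1 hs'
    obtain rfl := (hSy z).1 hs
    exact hyK (hS.mem_of_ne i j hij z hz hy)
  · intro s hs hs'
    obtain ⟨z, hz, rfl⟩ := Finset.mem_map.1 hs'
    obtain rfl := (hSy z).1 hs
    rfl

lemma isMinorOf_of_core (hS : CliqueSystem core K N blk m d) (hm : m + 1 = Fintype.card W)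
    (hd : d + 1 = H.minDegree) {G : SimpleGraph (V ⊕ A)} (hG : graph core N ≤ G) {a : A} {x : V}
    (hx : x ∈ core (blk a)) (hxa : x ∉ N a) {S : Set (V ⊕ A)} (hSc : (G.induce S).Connected)
    (haS : .inr a ∈ S) (hSx : ∀ z, Sum.inl z ∉ S) (hxS : ∃ s ∈ S, G.Adj s (.inl x)) :
    H.IsMinorOf G := by
  classical
  refine SimpleGraph.isMinorOf_of_clique (isClique_core (blk a) hG)
    (T := (insert x (N a)).map .inl) (by simp [hS.card_core, hm])
    (Finset.map_subset_map.2 (Finset.insert_subset hx (hS.nbr_subset a)))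
    (by rw [Finset.card_map, Finset.card_insert_of_notMem hxa, hS.card_nbr, hd]) hSc ?_ ?_
  · intro s hs hs'
    obtain ⟨z, hz, rfl⟩ := Finset.mem_map.1 hs'
    exact hSx z hs
  · intro t ht
    obtain ⟨z, hz, rfl⟩ := Finset.mem_map.1 ht
    rcases Finset.mem_insert.1 hz with rfl | hz
    · exact hxS
    · exact ⟨.inr a, haS, hG hz⟩

lemma isMinorOf_addEdge_inl_inr (hS : CliqueSystem core K N blk m d)
    (hm : m + 1 = Fintype.card W) (hd : d + 1 = H.minDegree)
    (hH : K.card + 1 = H.minDegree ∨ ∃ Z : Finset W, H.IsSep Z ∧ K.card + 1 = Z.card)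
    {x : V} {a : A} (hxa : x ∉ N a) : H.IsMinorOf ((graph core N).addEdge (.inl x) (.inr a)) := by
  have hle := SimpleGraph.le_addEdge (graph core N) (.inl x) (.inr a)
  have huv := SimpleGraph.addEdge_adj_self (graph core N) (u := .inl x) (v := .inr a) (by simp)
  by_cases hx : x ∈ core (blk a)
  · exact hS.isMinorOf_of_core hm hd hle hx hxa (SimpleGraph.induce_singleton_connected _ (.inr a))
      rfl (by simp) ⟨_, rfl, huv.symm⟩
  · obtain ⟨i, hi⟩ := hS.cover x
    obtain ⟨y, hy, hyK⟩ := hS.exists_nbr a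
    have hij : i ≠ blk a := by
      rintro rfl
      exact hx hi
    refine hS.isMinorOf_of_two_cores hm hH hle hij hi (fun h => hx (hS.subset_core _ h))
      (hS.nbr_subset a hy) hyK (S := {.inr a, .inl y}) ?_ (by simp) ⟨.inr a, by simp, huv⟩
    exact SimpleGraph.induce_pair_connected_of_adj (hle hy)

lemma isMinorOf_addEdge_inr_inr (hS : CliqueSystem core K N blk m d)
    (hm : m + 1 = Fintype.card W) (hd : d + 1 = H.minDegree)
    (hH : K.card + 1 = H.minDegree ∨ ∃ Z : Finset W, H.IsSep Z ∧ K.card + 1 = Z.card)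
    {a b : A} (hab : a ≠ b) : H.IsMinorOf ((graph core N).addEdge (.inr a) (.inr b)) := by
  have hle := SimpleGraph.le_addEdge (graph core N) (.inr a) (.inr b)
  have huv := SimpleGraph.addEdge_adj_self (graph core N) (u := .inr a) (v := .inr b)
    (by simpa using hab)
  by_cases hblk : blk a = blk b
  · obtain ⟨x, hxb, hxa⟩ : ∃ x ∈ N b, x ∉ N a := by
      by_contra! h
      refine hab (hS.nbr_injective (Finset.eq_of_subset_of_card_le h ?_).symm)
      rw [hS.card_nbr, hS.card_nbr]
    refine hS.isMinorOf_of_core hm hd hle (hblk ▸ hS.nbr_subset b hxb) hxa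
      (SimpleGraph.induce_pair_connected_of_adj huv) (by simp) (by simp) ⟨.inr b, by simp, hle hxb⟩
  · obtain ⟨x, hx, hxK⟩ := hS.exists_nbr a
    obtain ⟨y, hy, hyK⟩ := hS.exists_nbr b
    refine hS.isMinorOf_of_two_cores hm hH hle hblk (hS.nbr_subset a hx) hxK (hS.nbr_subset b hy)
      hyK (S := {.inr a, .inr b, .inl y}) ?_ (by simp) ⟨.inr a, by simp, hle hx⟩
    exact SimpleGraph.induce_insert_connected
      (SimpleGraph.induce_pair_connected_of_adj (hle (graph_adj_inr_inl.2 hy)))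
      (by simp) huv

theorem minorSaturated (hS : CliqueSystem core K N blk m d) (hm : m + 1 = Fintype.card W)
    (hd : d + 1 = H.minDegree) (hsep : ∀ Z : Finset W, Z.card ≤ K.card → ¬ H.IsSep Z)
    (hH : K.card + 1 = H.minDegree ∨ ∃ Z : Finset W, H.IsSep Z ∧ K.card + 1 = Z.card)
    (hK : K.card < Fintype.card W) : MinorSaturated H (graph core N) := by
  refine ⟨hS.not_isMinorOf (by omega) (by omega) hsep hK, ?_⟩
  rintro (x | a) (y | b) hne hadj
  · rw [graph_adj_inl_inl, not_and] at hadj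
    have hxy : ∀ i, x ∈ core i → y ∉ core i := fun i hx hy =>
      hadj (fun h => hne (h ▸ rfl)) ⟨i, hx, hy⟩
    obtain ⟨i, hi⟩ := hS.cover x
    obtain ⟨j, hj⟩ := hS.cover y
    have hij : i ≠ j := by
      rintro rfl
      exact hxy i hi hj
    exact hS.isMinorOf_of_two_cores hm hH (SimpleGraph.le_addEdge _ _ _) hij hi
      (fun h => hxy j (hS.subset_core j h) hj) hj (fun h => hxy i hi (hS.subset_core i h))
      (SimpleGraph.induce_singleton_connected _ (.inl y)) (by simp)
      ⟨_, rfl, SimpleGraph.addEdge_adj_self _ hne⟩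
  · exact hS.isMinorOf_addEdge_inl_inr hm hd hH hadj
  · rw [SimpleGraph.addEdge_comm]
    exact hS.isMinorOf_addEdge_inl_inr hm hd hH hadj
  · exact hS.isMinorOf_addEdge_inr_inr hm hd hH fun h => hne (h ▸ rfl)

end

end CliqueSystem

lemma MinorSaturated.of_iso {W V V' : Type*} {H : SimpleGraph W} {G : SimpleGraph V}
    {G' : SimpleGraph V'} (e : G ≃g G') (h : MinorSaturated H G) : MinorSaturated H G' := by
  refine ⟨fun h' => h.1 (h'.of_iso e.symm), fun u v huv hadj => ?_⟩
  have h' := h.2 (e.symm u) (e.symm v) (fun he => huv (e.symm.injective he))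
    (fun ha => hadj (e.symm.map_adj_iff.1 ha))
  refine h'.of_iso ⟨e.toEquiv, ?_⟩
  intro a b
  have he : ∀ a b, (e a = b) ↔ (a = e.symm b) := fun a b => e.toEquiv.eq_symm_apply.symm
  have hab := e.map_adj_iff (v := a) (w := b)
  rw [SimpleGraph.addEdge_adj, SimpleGraph.addEdge_adj]
  change G'.Adj (e a) (e b) ∨ s(e a, e b) = s(u, v) ∧ e a ≠ e b ↔ _
  rw [hab, Sym2.eq_iff, Sym2.eq_iff, he, he, he, he, e.injective.ne_iff]

lemma Nat.choose_two_le_choose {n r : ℕ} (hr : 2 ≤ r) (hrn : r + 2 ≤ n) :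
    n.choose 2 ≤ n.choose r := by
  induction n generalizing r with
  | zero => omega
  | succ n ih =>
    rcases Nat.lt_or_ge n (r + 2) with h | h
    · obtain rfl : n = r + 1 := by omega
      rw [Nat.choose_symm_of_eq_add (show r + 1 + 1 = 2 + r by omega)]
    · obtain ⟨r, rfl⟩ : ∃ s, r = s + 1 := ⟨r - 1, by omega⟩
      have h1 := ih (r := r + 1) hr h
      have h2 : n ≤ n.choose r := by
        rcases Nat.lt_or_ge r 2 with h' | h'
        · obtain rfl : r = 1 := by omega
          simp
        · refine le_trans ?_ (ih h' (by omega))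
          rw [Nat.choose_two_right, Nat.le_div_iff_mul_le two_pos]
          exact Nat.mul_le_mul_left n (by omega)
      rw [Nat.choose_succ_succ' n r, Nat.choose_succ_succ' n 1, Nat.choose_one_right]
      change n + n.choose 2 ≤ _
      omega

/-- The inclusion of a model clique as the `j`-th of `q` cliques sharing `k` vertices. -/
def blockEmbedding (k c : ℕ) {q : ℕ} (j : Fin q) : Fin k ⊕ Fin c ↪ Fin k ⊕ (Fin q × Fin c) :=
  (Function.Embedding.refl _).sumMap ⟨fun i => (j, i), fun _ _ h => (Prod.ext_iff.1 h).2⟩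

@[simp] lemma blockEmbedding_inl {k c q : ℕ} (j : Fin q) (x : Fin k) :
    blockEmbedding k c j (.inl x) = .inl x := rfl

@[simp] lemma blockEmbedding_inr {k c q : ℕ} (j : Fin q) (x : Fin c) :
    blockEmbedding k c j (.inr x) = .inr (j, x) := rfl

/-- The `d`-element subsets of a model clique that differ from the set of shared vertices. -/
def attachments (k c d : ℕ) : Finset (Finset (Fin k ⊕ Fin c)) :=
  (Finset.univ.powersetCard d).erase (Finset.univ.map .inl)

lemma exists_inr_mem_of_mem_attachments {k c d : ℕ} (hk : k ≤ d) {s : Finset (Fin k ⊕ Fin c)}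
    (hs : s ∈ attachments k c d) : ∃ x, Sum.inr x ∈ s := by
  obtain ⟨hne, hs⟩ := Finset.mem_erase.1 hs
  by_contra! h
  refine hne (Finset.eq_of_subset_of_card_le (fun x hx => ?_) ?_)
  · rcases x with x | x
    · simp
    · exact absurd hx (h x)
  · simpa [(Finset.mem_powersetCard.1 hs).2] using hk

lemma choose_le_card_attachments (k c d : ℕ) :
    (k + c).choose d ≤ (attachments k c d).card + 1 := by
  have h := Finset.pred_card_le_card_erase (s := Finset.univ.powersetCard d)
    (a := (Finset.univ.map .inl : Finset (Fin k ⊕ Fin c)))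
  rw [Finset.card_powersetCard, Finset.card_univ, Fintype.card_sum, Fintype.card_fin,
    Fintype.card_fin] at h
  unfold attachments
  omega

lemma cliqueSystem_blocks {k c d q : ℕ} (hk : k ≤ d) (hq : 0 < q)
    (A : Finset (Fin q × Finset (Fin k ⊕ Fin c)))
    (hA : A ⊆ Finset.univ ×ˢ attachments k c d) :
    CliqueSystem (fun j : Fin q => Finset.univ.map (blockEmbedding k c j))
      (Finset.univ.map .inl) (fun a : A => a.1.2.map (blockEmbedding k c a.1.1))
      (fun a => a.1.1) (k + c) d where
  subset_core j x hx := by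
    obtain ⟨y, -, rfl⟩ := Finset.mem_map.1 hx
    exact Finset.mem_map.2 ⟨.inl y, by simp, rfl⟩
  mem_of_ne i j hij v hv hv' := by
    obtain ⟨x, -, rfl⟩ := Finset.mem_map.1 hv
    obtain ⟨y, -, hxy⟩ := Finset.mem_map.1 hv'
    rcases x with x | x <;> rcases y with y | y <;> simp at hxy ⊢
    exact hij hxy.1.symm
  cover v := by
    rcases v with x | ⟨j, x⟩
    · exact ⟨⟨0, hq⟩, Finset.mem_map.2 ⟨.inl x, by simp, rfl⟩⟩
    · exact ⟨j, Finset.mem_map.2 ⟨.inr x, by simp, rfl⟩⟩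
  card_core j := by simp
  nbr_subset a := Finset.map_subset_map.2 (Finset.subset_univ _)
  card_nbr a := by
    have h := (Finset.mem_product.1 (hA a.2)).2
    rw [Finset.card_map]
    exact (Finset.mem_powersetCard.1 (Finset.mem_erase.1 h).2).2
  exists_nbr a := by
    obtain ⟨x, hx⟩ := exists_inr_mem_of_mem_attachments hk (Finset.mem_product.1 (hA a.2)).2
    exact ⟨.inr (a.1.1, x), Finset.mem_map.2 ⟨.inr x, hx, rfl⟩, by simp⟩
  nbr_injective := by
    rintro ⟨⟨i, s⟩, ha⟩ ⟨⟨j, t⟩, hb⟩ hab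
    dsimp only at hab
    obtain ⟨x, hx⟩ := exists_inr_mem_of_mem_attachments hk (Finset.mem_product.1 (hA ha)).2
    have hx' : Sum.inr (i, x) ∈ t.map (blockEmbedding k c j) :=
      hab ▸ Finset.mem_map.2 ⟨.inr x, hx, rfl⟩
    obtain rfl : i = j := by
      obtain ⟨y, -, hy⟩ := Finset.mem_map.1 hx'
      rcases y with y | y <;> simp at hy
      exact hy.1.symm
    obtain rfl := Finset.map_injective _ hab
    rfl

lemma ncard_edgeSet_blocks_le {k c d q : ℕ} (A : Finset (Fin q × Finset (Fin k ⊕ Fin c)))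
    (hA : A ⊆ Finset.univ ×ˢ attachments k c d) :
    (CliqueSystem.graph (fun j : Fin q => Finset.univ.map (blockEmbedding k c j))
      (fun a : A => a.1.2.map (blockEmbedding k c a.1.1))).edgeSet.ncard ≤
      k * k + q * (k * c) + q * c.choose 2 + A.card * d := by
  classical
  let f : ((Fin k × Fin k) ⊕ (Fin q × (Fin k × Fin c))) ⊕
      ((Fin q × {z : Sym2 (Fin c) // ¬ z.IsDiag}) ⊕ (Σ a : A, a.1.2)) →
      Sym2 ((Fin k ⊕ (Fin q × Fin c)) ⊕ A) :=
    Sum.elim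
      (Sum.elim (fun p => s(.inl (.inl p.1), .inl (.inl p.2)))
        (fun p => s(.inl (.inl p.2.1), .inl (.inr (p.1, p.2.2)))))
      (Sum.elim (fun p => p.2.1.map fun i => .inl (.inr (p.1, i)))
        (fun p => s(.inl (blockEmbedding k c p.1.1.1 p.2.1), .inr p.1)))
  have hsub : (CliqueSystem.graph (fun j : Fin q => Finset.univ.map (blockEmbedding k c j))
      (fun a : A => a.1.2.map (blockEmbedding k c a.1.1))).edgeSet ⊆ Set.range f := by
    have hcross : ∀ (x) (a : A), x ∈ a.1.2.map (blockEmbedding k c a.1.1) →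
        s(.inl x, .inr a) ∈ Set.range f := by
      intro x a hx
      obtain ⟨y, hy, rfl⟩ := Finset.mem_map.1 hx
      exact ⟨.inr (.inr ⟨a, y, hy⟩), rfl⟩
    intro e
    induction e with | _ p r
    intro h
    rw [SimpleGraph.mem_edgeSet] at h
    rcases p with p | a <;> rcases r with r | b
    · obtain ⟨hne, j, hp, hr⟩ := h
      obtain ⟨x, -, rfl⟩ := Finset.mem_map.1 hp
      obtain ⟨y, -, rfl⟩ := Finset.mem_map.1 hr
      rcases x with x | x <;> rcases y with y | y
      · exact ⟨.inl (.inl (x, y)), rfl⟩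
      · exact ⟨.inl (.inr (j, x, y)), rfl⟩
      · exact ⟨.inl (.inr (j, y, x)), Sym2.eq_swap⟩
      · exact ⟨.inr (.inl (j, ⟨s(x, y), fun hxy => hne (by
          rw [Sym2.mk_isDiag_iff] at hxy
          rw [hxy])⟩)), rfl⟩
    · exact hcross p b h
    · rw [Sym2.eq_swap]
      exact hcross r a h
    · exact h.elim
  have hcard : ∀ a : A, a.1.2.card = d := fun a =>
    (Finset.mem_powersetCard.1 (Finset.mem_erase.1 (Finset.mem_product.1 (hA a.2)).2).2).2
  calc _ ≤ (Set.range f).ncard := Set.ncard_le_ncard hsub (Set.toFinite _)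
    _ ≤ Set.univ.ncard := by
      rw [← Set.image_univ]
      exact Set.ncard_image_le
    _ = _ := by
      rw [Set.ncard_univ, Nat.card_eq_fintype_card]
      simp [hcard, Sym2.card_subtype_not_diag, -Fintype.card_subtype_compl]
      ring

/-- If `H` is connected with `δ(H) ≥ 3`, then
`sat(n, M(H)) ≤ δ(H)·n + O(1)`. -/
theorem sat_minor_upper_bound_minDegree
    {W : Type*} [Fintype W] (H : SimpleGraph W) [DecidableRel H.Adj]
    (hconn : H.Connected) (hδ : 3 ≤ H.minDegree) :
    ∃ C : ℚ, ∃ N : ℕ, ∀ n ≥ N, ∃ G : SimpleGraph (Fin n),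
      MinorSaturated H G ∧
      (G.edgeSet.ncard : ℚ) ≤ (H.minDegree : ℚ) * n + C := by
  classical
  have := hconn.nonempty
  obtain ⟨k, hkδ, hsep, hH⟩ := SimpleGraph.exists_card_isSep hconn (by omega)
  obtain ⟨d, hd⟩ : ∃ d, d + 1 = H.minDegree := ⟨H.minDegree - 1, by omega⟩
  have hδW := H.minDegree_lt_card
  obtain ⟨c, hc⟩ : ∃ c, k + c + 1 = Fintype.card W := ⟨Fintype.card W - 1 - k, by omega⟩
  obtain ⟨M, hM⟩ : ∃ M, M = (attachments k c d).card := ⟨_, rfl⟩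
  have hchoose := choose_le_card_attachments k c d
  rw [← hM] at hchoose
  have hM1 : 1 ≤ M := by
    have h1 : d + 1 ≤ (d + 1).choose d := by simp
    have h2 := Nat.choose_le_choose d (show d + 1 ≤ k + c by omega)
    omega
  have hcM : c.choose 2 ≤ c + M := by
    rcases Nat.lt_or_ge c 2 with hc2 | hc2
    · rw [Nat.choose_eq_zero_of_lt hc2]
      omega
    · have hdc : d + 2 ≤ k + c := by
        rcases hH with hH | ⟨Z, hZ, -⟩
        · omega
        · have := hZ.minDegree_add_two_le
          omega
      have h1 := Nat.choose_two_le_choose (show 2 ≤ d by omega) hdc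
      have h2 := Nat.choose_le_choose 2 (show c ≤ k + c by omega)
      omega
  refine ⟨((k * k + k + (c + M) : ℕ) : ℚ), (c + M) * (c + k), fun n hn => ?_⟩
  obtain ⟨q, hq⟩ : ∃ q, q = n / (c + M) + 1 := ⟨_, rfl⟩
  have hb : 0 < c + M := by omega
  have hq1 : c + k + 1 ≤ q := by
    rw [hq, Nat.add_le_add_iff_right, Nat.le_div_iff_mul_le hb, mul_comm]
    exact hn
  have hq2 : q * (c + M) ≤ n + (c + M) := by
    rw [hq, add_mul, one_mul, Nat.add_le_add_iff_right]
    exact Nat.div_mul_le_self n _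
  have hq3 : n ≤ q * (c + M) := by
    rw [hq, mul_comm]
    exact (Nat.lt_mul_div_succ n hb).le
  have hqM : q - 1 ≤ (q - 1) * M := Nat.le_mul_of_pos_right _ hM1
  have hqM' : (q - 1) * M + M = q * M := by
    rw [← Nat.succ_mul, Nat.succ_eq_add_one, Nat.sub_add_cancel (by omega)]
  rw [mul_add] at hq2 hq3
  obtain ⟨m, hm⟩ : ∃ m, k + q * c + m = n := ⟨n - (k + q * c), by omega⟩
  obtain ⟨A, hA, hAm⟩ := Finset.exists_subset_card_eq
    (s := (Finset.univ : Finset (Fin q)) ×ˢ attachments k c d) (n := m) (by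
      rw [Finset.card_product, Finset.card_univ, Fintype.card_fin, ← hM]
      omega)
  have hsat := (cliqueSystem_blocks (show k ≤ d by omega) (show 0 < q by omega) A hA).minorSaturated
    (H := H) hc hd (by simpa using hsep) (by simpa using hH) (by simp; omega)
  have hedge := ncard_edgeSet_blocks_le A hA
  have e : ((Fin k ⊕ (Fin q × Fin c)) ⊕ A) ≃ Fin n :=
    Fintype.equivFinOfCardEq (by simp [hAm, hm])
  have e' := SimpleGraph.Iso.map e (CliqueSystem.graph
    (fun j : Fin q => Finset.univ.map (blockEmbedding k c j))
    (fun a : A => a.1.2.map (blockEmbedding k c a.1.1)))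
  refine ⟨_, hsat.of_iso e', ?_⟩
  rw [Set.ncard, Set.encard_congr e'.symm.mapEdgeSet, ← Set.ncard]
  rw [hAm] at hedge
  have hle : k * k + q * (k * c) + q * c.choose 2 + m * d ≤
      H.minDegree * n + (k * k + k + (c + M)) := by
    have h1 : q * c.choose 2 ≤ q * c + q * M := by
      rw [← mul_add]
      exact Nat.mul_le_mul_left q hcM
    have h2 : q * (k * c) ≤ d * (q * c) := by
      rw [← mul_assoc, mul_comm q k, mul_assoc]
      exact Nat.mul_le_mul_right _ (by omega)
    have h3 : H.minDegree * n = d * k + d * (q * c) + m * d + n := by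
      rw [← hd, ← hm]
      ring
    omega
  exact_mod_cast hedge.trans hle
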